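/- arXiv:2108.04411 — 2 statements merged into one kernel-verified Lean document; each statement's English description precedes it below -/
import Mathlib

section
/- The following two statements are equivalent: (1) the abc-conjecture holds; (2) for every n ≥ 1, every choice of distinct points a_1, …, a_n ∈ ℙ¹(ℚ) and multiplicities m_i ≥ 2 with δ(𝐦) < 0, and every κ > 0, the function H^{δ(𝐦)+κ}_{(𝐚,𝐦)} (that is, the anti-canonical height H_{(𝐚,𝐦)} multiplied by max(|x|,|y|)^κ) has the Northcott property. -/
open Finset

/-- `phiM m k` is the smallest positive integer `d` such that `k * d` is a perfect
`m`-th power. -/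
noncomputable def phiM (m k : ℕ) : ℕ :=
  sInf {d : ℕ | 0 < d ∧ ∃ t : ℕ, k * d = t ^ m}

/-- The linear form `ℓ(x,y) = α·y − β·x` attached to the point `[α : β]` of `ℙ¹`. -/
def ell (α β x y : ℤ) : ℤ := α * y - β * x

/-- The Euler characteristic `δ(𝐦) = 2 − ∑ᵢ (1 − 1/mᵢ)` of the stacky curve
`𝔛(ℙ¹ : (𝐚, 𝐦))`. -/
noncomputable def deltaM {n : ℕ} (m : Fin n → ℕ) : ℝ :=
  2 - ∑ i, (1 - (m i : ℝ)⁻¹)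

/-- The height `H^δ_{(𝐚,𝐦)}(x,y) = ∏ᵢ φ_{mᵢ}(|ℓᵢ(x,y)|)^{1/mᵢ} · max(|x|,|y|)^δ`. -/
noncomputable def stackyHeight {n : ℕ} (α β : Fin n → ℤ) (m : Fin n → ℕ) (δ : ℝ)
    (x y : ℤ) : ℝ :=
  (∏ i, (phiM (m i) ((ell (α i) (β i) x y).natAbs) : ℝ) ^ ((m i : ℝ)⁻¹)) *
    ((max |x| |y| : ℤ) : ℝ) ^ δ

/-- A height function `H` on the stacky curve has the Northcott property if for every
real `T` there are only finitely many coprime pairs `(x,y)` (finiteness of the set of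
pairs is equivalent to finiteness up to simultaneous sign change) with `ℓᵢ(x,y) ≠ 0`
for all `i` and `H(x,y) ≤ T`. -/
def HasNorthcott {n : ℕ} (α β : Fin n → ℤ) (H : ℤ → ℤ → ℝ) : Prop :=
  ∀ T : ℝ, {p : ℤ × ℤ | IsCoprime p.1 p.2 ∧ (∀ i, ell (α i) (β i) p.1 p.2 ≠ 0) ∧
    H p.1 p.2 ≤ T}.Finite

/-- The radical of a positive integer: the product of its distinct prime factors. -/
def radN (k : ℕ) : ℕ := ∏ p ∈ k.primeFactors, p

/-- The `abc`-conjecture: for every `ε > 0` there is `C_ε > 0` such that all coprime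
positive integers `a, b, c` with `a + b = c` satisfy `c ≤ C_ε · rad(abc)^{1+ε}`. -/
def ABCConjecture : Prop :=
  ∀ ε : ℝ, 0 < ε → ∃ C : ℝ, 0 < C ∧
    ∀ a b c : ℕ, 0 < a → 0 < b → 0 < c → Nat.Coprime a b → a + b = c →
      (c : ℝ) ≤ C * (radN (a * b * c) : ℝ) ^ (1 + ε)

lemma radN_pos (k : ℕ) : 0 < radN k :=
  Finset.prod_pos fun _ hp => (Nat.prime_of_mem_primeFactors hp).pos

lemma radN_le_of_dvd {a b : ℕ} (h : a ∣ b) (hb : b ≠ 0) : radN a ≤ radN b :=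
  Finset.prod_le_prod_of_subset_of_one_le' (Nat.primeFactors_mono h hb)
    fun _ hp _ => (Nat.prime_of_mem_primeFactors hp).one_le

lemma radN_le_max (k : ℕ) : radN k ≤ max 1 k := by
  rcases Nat.eq_zero_or_pos k with rfl | hk
  · simp [radN]
  · exact (Nat.le_of_dvd hk (Nat.prod_primeFactors_dvd k)).trans (le_max_right _ _)

lemma radN_mul_le (a b : ℕ) : radN (a * b) ≤ radN a * radN b := by
  rcases eq_or_ne a 0 with rfl | ha
  · simp only [zero_mul]
    exact Nat.le_mul_of_pos_right _ (radN_pos b)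
  rcases eq_or_ne b 0 with rfl | hb
  · simp only [mul_zero]
    exact Nat.le_mul_of_pos_left _ (radN_pos a)
  have h := Finset.prod_union_inter (s₁ := a.primeFactors) (s₂ := b.primeFactors)
    (f := fun p : ℕ => p)
  unfold radN
  rw [Nat.primeFactors_mul ha hb, ← h]
  exact Nat.le_mul_of_pos_right _ (Finset.prod_pos fun p hp =>
    (Nat.prime_of_mem_primeFactors (Finset.mem_of_mem_inter_left hp)).pos)

lemma radN_pow_le (a k : ℕ) : radN (a ^ k) ≤ radN a := by
  rcases eq_or_ne k 0 with rfl | hk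
  · rw [pow_zero, radN, Nat.primeFactors_one, Finset.prod_empty]
    exact radN_pos a
  · simp [radN, Nat.primeFactors_pow _ hk]

lemma radN_prod_pow_le {ι : Type*} (s : Finset ι) (a k : ι → ℕ) :
    radN (∏ i ∈ s, a i ^ k i) ≤ ∏ i ∈ s, radN (a i) := by
  classical
  induction s using Finset.induction_on with
  | empty => simp [radN]
  | insert i s hi ih =>
    rw [Finset.prod_insert hi, Finset.prod_insert hi]
    exact (radN_mul_le _ _).trans (Nat.mul_le_mul (radN_pow_le _ _) ih)

lemma radN_le_of_mul_eq_pow {k d t m : ℕ} (h : k * d = t ^ m) (ht : t ≠ 0) :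
    radN k ≤ t := by
  have h1 : radN k ≤ radN (t ^ m) :=
    radN_le_of_dvd (h ▸ dvd_mul_right k d) (pow_ne_zero _ ht)
  have h2 := radN_le_max t
  rw [max_eq_right (Nat.pos_of_ne_zero ht)] at h2
  exact h1.trans ((radN_pow_le _ _).trans h2)

lemma exists_complement {m k : ℕ} (hm : 0 < m) (hk : k ≠ 0) :
    ∃ d, 0 < d ∧ d ≤ radN k ^ (m - 1) ∧ ∃ t : ℕ, k * d = t ^ m := by
  set c : ℕ → ℕ := fun p => (k.factorization p + (m - 1)) / m with hc
  have hle : ∀ p, k.factorization p ≤ m * c p ∧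
      m * c p ≤ k.factorization p + (m - 1) := fun p => by
    have h1 := Nat.div_add_mod (k.factorization p + (m - 1)) m
    have h2 := Nat.mod_lt (k.factorization p + (m - 1)) hm
    simp only [hc]
    constructor <;> omega
  refine ⟨∏ p ∈ k.primeFactors, p ^ (m * c p - k.factorization p),
    Finset.prod_pos fun p hp => pow_pos (Nat.prime_of_mem_primeFactors hp).pos _, ?_,
    ∏ p ∈ k.primeFactors, p ^ c p, ?_⟩
  · rw [radN, ← Finset.prod_pow]
    refine Finset.prod_le_prod' fun p hp => ?_
    refine Nat.pow_le_pow_right (Nat.prime_of_mem_primeFactors hp).pos ?_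
    have := hle p
    omega
  · conv_lhs => enter [1]; rw [← Nat.prod_factorization_pow_eq_self hk]
    rw [Finsupp.prod, Nat.support_factorization, ← Finset.prod_mul_distrib, ← Finset.prod_pow]
    refine Finset.prod_congr rfl fun p _ => ?_
    rw [← pow_add, ← pow_mul, mul_comm (c p)]
    congr 1
    have := hle p
    omega

lemma phiM_le_radN_pow {m k : ℕ} (hm : 0 < m) (hk : k ≠ 0) :
    phiM m k ≤ radN k ^ (m - 1) := by
  obtain ⟨d, hd, hle, ht⟩ := exists_complement hm hk
  exact (Nat.sInf_le (show d ∈ {d : ℕ | 0 < d ∧ ∃ t : ℕ, k * d = t ^ m} from ⟨hd, ht⟩)).trans hle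

lemma phiM_spec {m k : ℕ} (hm : 0 < m) (hk : k ≠ 0) :
    0 < phiM m k ∧ ∃ t : ℕ, k * phiM m k = t ^ m := by
  obtain ⟨d, hd, -, ht⟩ := exists_complement hm hk
  exact Nat.sInf_mem (s := {d : ℕ | 0 < d ∧ ∃ t : ℕ, k * d = t ^ m}) ⟨d, hd, ht⟩

lemma radN_le_rpow_phiM {m k : ℕ} (hm : 0 < m) (hk : k ≠ 0) :
    (radN k : ℝ) ≤ (k : ℝ) ^ (m : ℝ)⁻¹ * (phiM m k : ℝ) ^ (m : ℝ)⁻¹ := by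
  obtain ⟨h0, t, ht⟩ := phiM_spec hm hk
  have ht0 : t ≠ 0 := by
    rintro rfl
    rw [zero_pow hm.ne'] at ht
    exact (Nat.mul_ne_zero hk h0.ne') ht
  have h := radN_le_of_mul_eq_pow ht ht0
  rw [← Real.mul_rpow (by positivity) (by positivity)]
  have h2 : (k : ℝ) * phiM m k = (t : ℝ) ^ m := by exact_mod_cast ht
  rw [h2, Real.pow_rpow_inv_natCast (by positivity) hm.ne']
  exact_mod_cast h

lemma rpow_phiM_le {m k : ℕ} (hm : 0 < m) (hk : k ≠ 0) :
    (phiM m k : ℝ) ^ (m : ℝ)⁻¹ ≤ (radN k : ℝ) ^ (1 - (m : ℝ)⁻¹) := by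
  have h : (phiM m k : ℝ) ≤ (radN k : ℝ) ^ (m - 1) := by
    exact_mod_cast phiM_le_radN_pow hm hk
  have hm' : (m : ℝ) ≠ 0 := by exact_mod_cast hm.ne'
  refine (Real.rpow_le_rpow (by positivity) h (by positivity)).trans_eq ?_
  rw [← Real.rpow_natCast, ← Real.rpow_mul (by positivity), Nat.cast_sub hm]
  congr 1
  push_cast
  field_simp

section Belyi

open Polynomial

lemma prod_mul_derivative_prod_pow {ι R : Type*} [DecidableEq ι] [CommRing R] (s : Finset ι)
    (v : ι → R) (e : ι → ℕ) :
    (∏ i ∈ s, (X - C (v i))) * derivative (∏ i ∈ s, (X - C (v i)) ^ e i) =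
      (∏ i ∈ s, (X - C (v i)) ^ e i) *
        ∑ i ∈ s, (e i : R[X]) * ∏ j ∈ s.erase i, (X - C (v j)) := by
  rw [derivative_prod_finset, Finset.mul_sum, Finset.mul_sum]
  refine Finset.sum_congr rfl fun i hi => ?_
  rw [← Finset.mul_prod_erase s _ hi, ← Finset.mul_prod_erase s (fun i => (X - C (v i)) ^ e i) hi]
  rcases Nat.eq_zero_or_pos (e i) with h | h
  · simp [h]
  · obtain ⟨k, hk⟩ := Nat.exists_eq_succ_of_ne_zero h.ne'
    rw [hk, derivative_X_sub_C_pow, Nat.succ_eq_add_one, Nat.add_sub_cancel, pow_succ]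
    push_cast [map_add, map_natCast, map_one]
    ring

/-- If `A` and `B` are monic of degree `d`, then the degree of `A - B` is controlled by that of
the Wronskian of `A` and `B`. -/
lemma natDegree_sub_le_of_wronskian {A B : ℚ[X]} {d k : ℕ} (hA : A.Monic) (hB : B.Monic)
    (hAd : A.natDegree = d) (hBd : B.natDegree = d) (hne : A ≠ B)
    (hW : (derivative A * B - A * derivative B).natDegree ≤ k) :
    (A - B).natDegree + d ≤ k + 1 := by
  set D := A - B with hD
  have hD0 : D ≠ 0 := sub_ne_zero.mpr hne
  have hlt : D.natDegree < d := by
    have h : D.degree < A.degree := degree_sub_lt_left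
      (by rw [degree_eq_natDegree hA.ne_zero, degree_eq_natDegree hB.ne_zero, hAd, hBd])
      hA.ne_zero (by rw [hA.leadingCoeff, hB.leadingCoeff])
    rw [← hAd]
    exact natDegree_lt_natDegree hD0 h
  have hWD : derivative A * B - A * derivative B = derivative D * B - D * derivative B := by
    rw [hD, derivative_sub]; ring
  rw [hWD] at hW
  by_contra! hcon
  have hd : 0 < d := by omega
  have hB' : (derivative B).coeff (d - 1) = d := by
    rw [coeff_derivative, Nat.sub_add_cancel hd, ← hBd, coeff_natDegree, hB.leadingCoeff, hBd]
    have : ((d - 1 : ℕ) : ℚ) = d - 1 := by push_cast [Nat.cast_sub hd]; ring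
    rw [this]; ring
  have h2 : (D * derivative B).coeff (D.natDegree + (d - 1)) = D.leadingCoeff * d := by
    rw [coeff_mul_add_eq_of_natDegree_le le_rfl ((natDegree_derivative_le B).trans (by omega)), hB']
    rfl
  have h1 : (derivative D * B).coeff (D.natDegree + (d - 1)) = D.leadingCoeff * D.natDegree := by
    rcases Nat.eq_zero_or_pos D.natDegree with h | h
    · rw [h, natDegree_eq_zero.mp h |>.choose_spec.symm]
      simp
    · rw [show D.natDegree + (d - 1) = (D.natDegree - 1) + d by omega,
        coeff_mul_add_eq_of_natDegree_le (natDegree_derivative_le D) hBd.le, coeff_derivative,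
        Nat.sub_add_cancel h, ← hBd, coeff_natDegree, coeff_natDegree, hB.leadingCoeff]
      push_cast [Nat.cast_sub h]; ring
  have h3 : (derivative D * B - D * derivative B).coeff (D.natDegree + (d - 1)) = 0 :=
    coeff_eq_zero_of_natDegree_lt (by omega)
  rw [coeff_sub, h1, h2, ← mul_sub] at h3
  rcases mul_eq_zero.mp h3 with h | h
  · exact hD0 (leadingCoeff_eq_zero.mp h)
  · have : (D.natDegree : ℚ) < d := by exact_mod_cast hlt
    linarith

/-- An explicit Belyi function `∏ (X - v i) ^ r i` for rational points `v i` and `∞`, where the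
integers `r i` are proportional to the Lagrange weights of the `v i`; the exponents `e` and `f` are
the positive and negative parts of `r`. -/
lemma exists_belyi_exponents {n : ℕ} (hn : 2 ≤ n) (v : Fin n → ℚ) (hv : Function.Injective v) :
    ∃ e f : Fin n → ℕ, (∀ i, e i = 0 ∨ f i = 0) ∧ ∑ i, e i = ∑ i, f i ∧
      ((∏ i, (X - C (v i)) ^ e i) - ∏ i, (X - C (v i)) ^ f i).natDegree + n ≤ (∑ i, e i) + 1 := by
  classical
  set wt : Fin n → ℚ := fun i => ∏ j ∈ univ.erase i, (v i - v j)⁻¹ with hwt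
  have hwt0 : ∀ i, wt i ≠ 0 := fun i => Finset.prod_ne_zero_iff.mpr fun j hj =>
    inv_ne_zero (sub_ne_zero.mpr fun h => (Finset.ne_of_mem_erase hj) (hv h).symm)
  have hbasis : ∑ i, C (wt i) * ∏ j ∈ univ.erase i, (X - C (v j)) = 1 := by
    have : Nonempty (Fin n) := ⟨⟨0, by omega⟩⟩
    rw [← Lagrange.sum_basis (s := univ) (v := v) hv.injOn univ_nonempty]
    refine Finset.sum_congr rfl fun i _ => ?_
    simp only [Lagrange.basis, Lagrange.basisDivisor, Finset.prod_mul_distrib, hwt, map_prod]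
  have hsum : ∑ i, wt i = 0 := by
    have h := congrArg (fun P : ℚ[X] => P.coeff (n - 1)) hbasis
    simp only [finsetSum_coeff, coeff_C_mul] at h
    rw [coeff_one, if_neg (by omega)] at h
    rw [← h]
    refine Finset.sum_congr rfl fun i _ => ?_
    have hmon : (∏ j ∈ univ.erase i, (X - C (v j))).Monic :=
      monic_prod_of_monic _ _ fun j _ => monic_X_sub_C _
    have hdeg : (∏ j ∈ univ.erase i, (X - C (v j))).natDegree = n - 1 := by
      rw [natDegree_prod_of_monic _ _ fun j _ => monic_X_sub_C _]
      simp
    rw [← hdeg, coeff_natDegree, hmon.leadingCoeff, mul_one]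
  obtain ⟨b, hb⟩ := IsLocalization.exist_integer_multiples_of_finite (nonZeroDivisors ℤ) wt
  choose r hr using hb
  have hb0 : (b : ℤ) ≠ 0 := nonZeroDivisors.coe_ne_zero b
  have hr' : ∀ i, (r i : ℚ) = (b : ℤ) * wt i := fun i => by
    have := hr i
    simpa using this
  have hr0 : ∀ i, r i ≠ 0 := fun i h => by
    have := hr' i
    rw [h, Int.cast_zero] at this
    exact mul_ne_zero (by exact_mod_cast hb0) (hwt0 i) this.symm
  have hrsum : ∑ i, r i = 0 := by
    have : ((∑ i, r i : ℤ) : ℚ) = 0 := by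
      push_cast
      rw [Finset.sum_congr rfl fun i _ => hr' i, ← Finset.mul_sum, hsum, mul_zero]
    exact_mod_cast this
  set e : Fin n → ℕ := fun i => (r i).toNat with he
  set f : Fin n → ℕ := fun i => (-r i).toNat with hf
  have hef : ∀ i, (e i : ℤ) - f i = r i := fun i => by simp only [he, hf]; omega
  have hsum' : ∑ i, e i = ∑ i, f i := by
    have : (∑ i, (e i : ℤ)) - ∑ i, (f i : ℤ) = 0 := by
      rw [← Finset.sum_sub_distrib, Finset.sum_congr rfl fun i _ => hef i, hrsum]
    exact_mod_cast sub_eq_zero.mp this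
  refine ⟨e, f, fun i => by simp only [he, hf]; omega, hsum', ?_⟩
  set A : ℚ[X] := ∏ i, (X - C (v i)) ^ e i with hA
  set B : ℚ[X] := ∏ i, (X - C (v i)) ^ f i with hB
  set N : ℚ[X] := ∏ i, (X - C (v i)) with hN
  have hAm : A.Monic := monic_prod_of_monic _ _ fun i _ => (monic_X_sub_C _).pow _
  have hBm : B.Monic := monic_prod_of_monic _ _ fun i _ => (monic_X_sub_C _).pow _
  have hNm : N.Monic := monic_prod_of_monic _ _ fun i _ => monic_X_sub_C _
  have hAd : A.natDegree = ∑ i, e i := by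
    rw [hA, natDegree_prod_of_monic _ _ fun i _ => (monic_X_sub_C _).pow _]
    simp
  have hBd : B.natDegree = ∑ i, e i := by
    rw [hB, natDegree_prod_of_monic _ _ fun i _ => (monic_X_sub_C _).pow _, hsum']
    simp
  have hNd : N.natDegree = n := by
    rw [hN, natDegree_prod_of_monic _ _ fun i _ => monic_X_sub_C _]
    simp
  have hne : A ≠ B := by
    intro hAB
    have hA0 := congrArg (eval (v ⟨0, by omega⟩)) hAB
    simp only [hA, hB, eval_prod, eval_pow, eval_sub, eval_X, eval_C] at hA0
    have key : ∀ g : Fin n → ℕ, (∏ i, (v ⟨0, by omega⟩ - v i) ^ g i) = 0 ↔ g ⟨0, by omega⟩ ≠ 0 := by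
      intro g
      rw [Finset.prod_eq_zero_iff]
      constructor
      · rintro ⟨i, -, hi⟩
        obtain ⟨h1, h2⟩ := pow_eq_zero_iff'.mp hi
        rwa [hv (sub_eq_zero.mp h1)]
      · intro h
        exact ⟨⟨0, by omega⟩, mem_univ _, by simp [h]⟩
    have h1 := key e
    rw [hA0, key f] at h1
    have h2 := hr0 ⟨0, by omega⟩
    simp only [he, hf] at h1
    omega
  have hWN : N * (derivative A * B - A * derivative B) = A * B * C ((b : ℤ) : ℚ) := by
    have h1 := prod_mul_derivative_prod_pow univ v e
    have h2 := prod_mul_derivative_prod_pow univ v f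
    have h3 : (∑ i, (e i : ℚ[X]) * ∏ j ∈ univ.erase i, (X - C (v j))) -
        ∑ i, (f i : ℚ[X]) * ∏ j ∈ univ.erase i, (X - C (v j)) = C ((b : ℤ) : ℚ) := by
      rw [← Finset.sum_sub_distrib, ← mul_one (C ((b : ℤ) : ℚ)), ← hbasis, Finset.mul_sum]
      refine Finset.sum_congr rfl fun i _ => ?_
      rw [← sub_mul, ← mul_assoc, ← C_mul, ← hr' i, ← hef i]
      simp
    rw [← hA, ← hN] at h1
    rw [← hB, ← hN] at h2
    rw [← h3]
    linear_combination B * h1 - A * h2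
  have hbC : ((b : ℤ) : ℚ) ≠ 0 := by exact_mod_cast hb0
  have hW0 : derivative A * B - A * derivative B ≠ 0 := by
    intro h
    rw [h, mul_zero] at hWN
    exact mul_ne_zero (mul_ne_zero hAm.ne_zero hBm.ne_zero) (C_ne_zero.mpr hbC) hWN.symm
  have hdeg := congrArg natDegree hWN
  rw [natDegree_mul hNm.ne_zero hW0, natDegree_mul_C hbC,
    natDegree_mul hAm.ne_zero hBm.ne_zero, hAd, hBd, hNd] at hdeg
  have := natDegree_sub_le_of_wronskian hAm hBm hAd hBd hne le_rfl
  omega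

end Belyi

lemma ABCConjecture.natAbs_sub_bound (habc : ABCConjecture) {ε : ℝ} (hε : 0 < ε) :
    ∃ C : ℝ, 1 ≤ C ∧ ∀ a b : ℤ, a ≠ 0 → b ≠ 0 → a ≠ b → IsCoprime a b →
      (a.natAbs : ℝ) ≤ C * (radN (a * b * (a - b)).natAbs : ℝ) ^ (1 + ε) := by
  obtain ⟨C, hC, h⟩ := habc ε hε
  refine ⟨max C 1, le_max_right _ _, fun a b ha hb hab hcop => ?_⟩
  set c := a - b with hc
  have hc0 : c ≠ 0 := sub_ne_zero.mpr hab
  have hac : IsCoprime a c := by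
    obtain ⟨s, t, hst⟩ := hcop
    exact ⟨s + t, -t, by rw [hc]; linear_combination hst⟩
  have hbc : IsCoprime b c := by
    obtain ⟨s, t, hst⟩ := hcop
    exact ⟨s + t, s, by rw [hc]; linear_combination hst⟩
  have key : ∀ x y z : ℕ, 0 < x → 0 < y → 0 < z → Nat.Coprime x y → x + y = z →
      x * y * z = (a * b * c).natAbs → a.natAbs ≤ z →
      (a.natAbs : ℝ) ≤ max C 1 * (radN (a * b * c).natAbs : ℝ) ^ (1 + ε) := by
    intro x y z hx hy hz hxy hxyz hprod hle
    have h1 := h x y z hx hy hz hxy hxyz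
    rw [hprod] at h1
    calc (a.natAbs : ℝ) ≤ z := by exact_mod_cast hle
      _ ≤ _ := h1
      _ ≤ _ := by gcongr; exact le_max_left _ _
  have hA := Int.natAbs_pos.mpr ha
  have hB := Int.natAbs_pos.mpr hb
  have hC' := Int.natAbs_pos.mpr hc0
  rw [Int.isCoprime_iff_gcd_eq_one] at hcop hac hbc
  have hcases : a.natAbs + b.natAbs = c.natAbs ∨ b.natAbs + c.natAbs = a.natAbs ∨
      a.natAbs + c.natAbs = b.natAbs := by omega
  rcases hcases with h1 | h1 | h1
  · exact key _ _ _ hA hB hC' hcop h1 (by simp only [Int.natAbs_mul]) (by omega)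
  · exact key _ _ _ hB hC' hA hbc h1 (by simp only [Int.natAbs_mul]; ring) (by omega)
  · exact key _ _ _ hA hC' hB hac h1 (by simp only [Int.natAbs_mul]; ring) (by omega)

/-- The `abc`-conjecture for the difference of two integers whose common divisors divide `N`. -/
lemma ABCConjecture.natAbs_bound_of_combination (habc : ABCConjecture) {ε : ℝ} (hε : 0 < ε) :
    ∃ C : ℝ, 1 ≤ C ∧ ∀ a b N : ℤ, a ≠ 0 → b ≠ 0 → N ≠ 0 → (∃ s t, s * a + t * b = N) →
      (a.natAbs : ℝ) ≤ N.natAbs * C * (radN (a * b * (a - b)).natAbs : ℝ) ^ (1 + ε) := by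
  obtain ⟨C, hC, h⟩ := habc.natAbs_sub_bound hε
  refine ⟨C, hC, fun a b N ha hb hN ⟨s, t, hst⟩ => ?_⟩
  have hrad : ∀ k : ℕ, (1 : ℝ) ≤ (radN k : ℝ) ^ (1 + ε) := fun k =>
    Real.one_le_rpow (by exact_mod_cast radN_pos k) (by positivity)
  rcases eq_or_ne a b with rfl | hab
  · have h1 : a.natAbs ≤ N.natAbs :=
      Nat.le_of_dvd (Int.natAbs_pos.mpr hN) (Int.natAbs_dvd_natAbs.mpr ⟨s + t, by rw [← hst]; ring⟩)
    calc (a.natAbs : ℝ) ≤ N.natAbs := by exact_mod_cast h1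
      _ = N.natAbs * 1 * 1 := by ring
      _ ≤ _ := by gcongr; exact hrad _
  · obtain ⟨g, a', b', hg, hcop, rfl, rfl⟩ : ∃ g a' b' : ℤ, g ≠ 0 ∧ IsCoprime a' b' ∧
        a = g * a' ∧ b = g * b' := by
      obtain ⟨a', ha'⟩ := Int.gcd_dvd_left a b
      obtain ⟨b', hb'⟩ := Int.gcd_dvd_right a b
      have hg : (Int.gcd a b : ℤ) ≠ 0 := by
        intro h0
        rw [h0, zero_mul] at ha'
        exact ha ha'
      refine ⟨Int.gcd a b, a', b', hg, ?_, ha', hb'⟩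
      refine ⟨Int.gcdA a b, Int.gcdB a b, mul_left_cancel₀ hg ?_⟩
      have := Int.gcd_eq_gcd_ab a b
      linear_combination (-1 : ℤ) * this - a.gcdA b * ha' - a.gcdB b * hb'
    have ha' : a' ≠ 0 := right_ne_zero_of_mul ha
    have hb' : b' ≠ 0 := right_ne_zero_of_mul hb
    have hab' : a' ≠ b' := fun h => hab (by rw [h])
    have h1 := h a' b' ha' hb' hab' hcop
    have hgN : g.natAbs ≤ N.natAbs :=
      Nat.le_of_dvd (Int.natAbs_pos.mpr hN)
        (Int.natAbs_dvd_natAbs.mpr ⟨s * a' + t * b', by rw [← hst]; ring⟩)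
    have hr : radN (a' * b' * (a' - b')).natAbs ≤
        radN (g * a' * (g * b') * (g * a' - g * b')).natAbs := by
      refine radN_le_of_dvd (Int.natAbs_dvd_natAbs.mpr ⟨g ^ 3, by ring⟩) (Int.natAbs_ne_zero.mpr ?_)
      exact mul_ne_zero (mul_ne_zero ha hb) (sub_ne_zero.mpr hab)
    rw [Int.natAbs_mul g a']
    push_cast only [Nat.cast_mul]
    rw [mul_assoc]
    gcongr
    refine h1.trans ?_
    gcongr

lemma combination_mul {R : Type*} [CommRing R] {a a' b N N' : R}
    (h : ∃ s t, s * a + t * b = N) (h' : ∃ s t, s * a' + t * b = N') :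
    ∃ s t, s * (a * a') + t * b = N * N' := by
  obtain ⟨s, t, rfl⟩ := h
  obtain ⟨s', t', rfl⟩ := h'
  exact ⟨s * s', s * a * t' + t * s' * a' + t * t' * b, by ring⟩

lemma combination_symm {R : Type*} [CommRing R] {a b N : R} (h : ∃ s t, s * a + t * b = N) :
    ∃ s t, s * b + t * a = N := by
  obtain ⟨s, t, rfl⟩ := h
  exact ⟨t, s, add_comm _ _⟩

lemma combination_pow {R : Type*} [CommRing R] {a b N : R} (h : ∃ s t, s * a + t * b = N)
    (k : ℕ) : ∃ s t, s * a ^ k + t * b = N ^ k := by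
  induction k with
  | zero => exact ⟨1, 0, by simp⟩
  | succ k ih => simpa only [pow_succ] using combination_mul ih h

lemma combination_prod {R ι : Type*} [CommRing R] {b : R} (s : Finset ι) {a N : ι → R}
    (h : ∀ i ∈ s, ∃ x y, x * a i + y * b = N i) :
    ∃ x y, x * (∏ i ∈ s, a i) + y * b = ∏ i ∈ s, N i := by
  classical
  induction s using Finset.induction_on with
  | empty => exact ⟨1, 0, by simp⟩
  | insert i s hi ih =>
    rw [Finset.prod_insert hi, Finset.prod_insert hi]
    exact combination_mul (h i (Finset.mem_insert_self _ _))
      (ih fun j hj => h j (Finset.mem_insert_of_mem hj))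

lemma combination_prod_pow {R ι : Type*} [CommRing R] [Fintype ι] [DecidableEq ι] {l : ι → R}
    {N : ι → ι → R} {e f : ι → ℕ} (hef : ∀ i, e i = 0 ∨ f i = 0)
    (h : ∀ i j, i ≠ j → ∃ s t, s * l i + t * l j = N i j) :
    ∃ s t, s * (∏ i, l i ^ e i) + t * (∏ i, l i ^ f i) =
      ∏ i, ∏ j, if i = j then 1 else (N i j ^ e i) ^ f j := by
  refine combination_prod _ fun i _ => combination_symm (combination_prod _ fun j _ => ?_)
  split_ifs with hij
  · subst hij
    rcases hef i with h0 | h0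
    · exact ⟨0, 1, by simp [h0]⟩
    · exact ⟨1, 0, by simp [h0]⟩
  · exact combination_pow (combination_symm (combination_pow (h i j hij) _)) _

lemma combination_linear_forms {R : Type*} [CommRing R] {u w : R} (h : IsCoprime u w)
    (p q p' q' : R) :
    ∃ s t, s * (p * u - q * w) + t * (p' * u - q' * w) = p' * q - p * q' := by
  obtain ⟨r, s, hrs⟩ := h
  exact ⟨-s * p' - r * q', s * p + r * q, by linear_combination (p' * q - p * q') * hrs⟩

/-- Homogeneous form of `exists_belyi_exponents`. -/
lemma exists_belyi_forms {n : ℕ} (hn : 2 ≤ n) (p q : Fin n → ℤ) (hp : ∀ i, p i ≠ 0)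
    (hpq : ∀ i j, i ≠ j → p i * q j ≠ p j * q i) :
    ∃ (e f : Fin n → ℕ) (k : ℕ) (c c' : ℤ) (G : ℤ → ℤ → ℤ) (K : ℕ),
      (∀ i, e i = 0 ∨ f i = 0) ∧ ∑ i, e i = k + (n - 1) ∧ ∑ i, f i = k + (n - 1) ∧
      c ≠ 0 ∧ c' ≠ 0 ∧
      (∀ u w, w ≠ 0 → c * ∏ i, (p i * u - q i * w) ^ e i - c' * ∏ i, (p i * u - q i * w) ^ f i =
        w ^ (n - 1) * G u w) ∧
      ∀ u w, (G u w).natAbs ≤ K * max u.natAbs w.natAbs ^ k := by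
  set v : Fin n → ℚ := fun i => q i / p i with hv
  have hpQ : ∀ i, (p i : ℚ) ≠ 0 := fun i => by exact_mod_cast hp i
  have hinj : Function.Injective v := by
    intro i j hij
    by_contra hne
    simp only [hv] at hij
    rw [div_eq_div_iff (hpQ i) (hpQ j)] at hij
    refine hpq i j hne ?_
    have : q i * p j = q j * p i := by exact_mod_cast hij
    linarith
  obtain ⟨e, f, hef, hsum, hdeg⟩ := exists_belyi_exponents hn v hinj
  set D : Polynomial ℚ := (∏ i, (Polynomial.X - Polynomial.C (v i)) ^ e i) -
    ∏ i, (Polynomial.X - Polynomial.C (v i)) ^ f i with hD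
  set k := ∑ i, e i + 1 - n with hk
  have hd : ∑ i, e i = k + (n - 1) := by omega
  obtain ⟨b, hb⟩ := IsLocalization.exist_integer_multiples_of_finite (nonZeroDivisors ℤ)
    (fun j : Fin (k + 1) => D.coeff j)
  choose g hg using hb
  have hb0 : (b : ℤ) ≠ 0 := nonZeroDivisors.coe_ne_zero b
  have hg' : ∀ j, (g j : ℚ) = (b : ℤ) * D.coeff j := fun j => by
    have := hg j
    simpa using this
  set PA := ∏ i, p i ^ e i with hPA
  set PB := ∏ i, p i ^ f i with hPB
  have hPA0 : PA ≠ 0 := Finset.prod_ne_zero_iff.mpr fun i _ => pow_ne_zero _ (hp i)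
  have hPB0 : PB ≠ 0 := Finset.prod_ne_zero_iff.mpr fun i _ => pow_ne_zero _ (hp i)
  refine ⟨e, f, k, b * PB, b * PA, fun u w => PA * PB * ∑ j : Fin (k + 1),
    g j * (u ^ (j : ℕ) * w ^ (k - j)), (PA * PB).natAbs * ∑ j, (g j).natAbs, hef, hd, hsum ▸ hd,
    mul_ne_zero hb0 hPB0, mul_ne_zero hb0 hPA0, fun u w hw => ?_, fun u w => ?_⟩
  · have hwQ : (w : ℚ) ≠ 0 := by exact_mod_cast hw
    have hfac : ∀ m : Fin n → ℕ, ∑ i, m i = k + (n - 1) →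
        ∏ i, ((p i : ℚ) * u - q i * w) ^ m i =
          (∏ i, (p i : ℚ) ^ m i) * (w : ℚ) ^ (k + (n - 1)) * ∏ i, ((u / w : ℚ) - v i) ^ m i := by
      intro m hm
      rw [← hm, ← Finset.prod_pow_eq_pow_sum, ← Finset.prod_mul_distrib, ← Finset.prod_mul_distrib]
      refine Finset.prod_congr rfl fun i _ => ?_
      rw [← mul_pow, ← mul_pow]
      congr 1
      have := hpQ i
      simp only [hv]
      field_simp
    have hDe : D.eval (u / w : ℚ) =
        ∏ i, ((u / w : ℚ) - v i) ^ e i - ∏ i, ((u / w : ℚ) - v i) ^ f i := by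
      simp [hD, Polynomial.eval_prod]
    have hDs : ((b : ℤ) : ℚ) * (w : ℚ) ^ k * D.eval (u / w : ℚ) =
        ∑ j : Fin (k + 1), (g j : ℚ) * ((u : ℚ) ^ (j : ℕ) * (w : ℚ) ^ (k - j)) := by
      rw [Polynomial.eval_eq_sum_range' (show D.natDegree < k + 1 by omega), Finset.sum_range,
        Finset.mul_sum]
      refine Finset.sum_congr rfl fun j _ => ?_
      have hwk : (w : ℚ) ^ k = w ^ (k - j) * w ^ (j : ℕ) := by
        rw [← pow_add, Nat.sub_add_cancel (Nat.lt_succ_iff.mp j.2)]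
      rw [hg', hwk, div_pow]
      field_simp
    have key : ((b * PB * ∏ i, (p i * u - q i * w) ^ e i -
        b * PA * ∏ i, (p i * u - q i * w) ^ f i : ℤ) : ℚ) =
        ((w ^ (n - 1) * (PA * PB * ∑ j : Fin (k + 1), g j * (u ^ (j : ℕ) * w ^ (k - j))) : ℤ) :
          ℚ) := by
      push_cast
      rw [hfac e hd, hfac f (hsum ▸ hd), ← hDs, hDe, hPA, hPB]
      push_cast
      ring
    exact_mod_cast key
  · simp only
    rw [Int.natAbs_mul, mul_assoc, Finset.sum_mul]
    refine Nat.mul_le_mul_left _ ((Int.natAbs_sum_le _ _).trans (Finset.sum_le_sum fun j _ => ?_))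
    rw [Int.natAbs_mul, Int.natAbs_mul, Int.natAbs_pow, Int.natAbs_pow]
    refine Nat.mul_le_mul_left _ ?_
    calc u.natAbs ^ (j : ℕ) * w.natAbs ^ (k - j)
        ≤ max u.natAbs w.natAbs ^ (j : ℕ) * max u.natAbs w.natAbs ^ (k - j) := by
          gcongr
          · exact le_max_left _ _
          · exact le_max_right _ _
      _ = _ := by rw [← pow_add, Nat.add_sub_cancel' (Nat.lt_succ_iff.mp j.2)]

lemma exists_max_le_max_linear_forms {n : ℕ} (p q : Fin n → ℤ)
    (hpq : ∀ i j, i ≠ j → p i * q j ≠ p j * q i) :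
    ∃ L : ℕ, ∀ i j, i ≠ j → ∀ u w : ℤ, max u.natAbs w.natAbs ≤
      L * max (p i * u - q i * w).natAbs (p j * u - q j * w).natAbs := by
  set S := ∑ i, ((p i).natAbs + (q i).natAbs) with hS
  have hle : ∀ i, (p i).natAbs + (q i).natAbs ≤ S := fun i =>
    Finset.single_le_sum (f := fun i => (p i).natAbs + (q i).natAbs) (fun _ _ => Nat.zero_le _)
      (Finset.mem_univ i)
  refine ⟨2 * S, fun i j hij u w => ?_⟩
  set x := p i * u - q i * w with hx
  set y := p j * u - q j * w with hy
  have hΔ : 1 ≤ (p i * q j - p j * q i).natAbs :=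
    Int.natAbs_pos.mpr (sub_ne_zero.mpr (hpq i j hij))
  have hcomb : ∀ (z r s : ℤ), r.natAbs ≤ S → s.natAbs ≤ S →
      (p i * q j - p j * q i) * z = r * x - s * y → z.natAbs ≤ 2 * S * max x.natAbs y.natAbs := by
    intro z r s hr hs h
    calc z.natAbs ≤ (p i * q j - p j * q i).natAbs * z.natAbs := Nat.le_mul_of_pos_left _ hΔ
      _ = (r * x - s * y).natAbs := by rw [← Int.natAbs_mul, h]
      _ ≤ (r * x).natAbs + (s * y).natAbs := Int.natAbs_sub_le _ _
      _ = r.natAbs * x.natAbs + s.natAbs * y.natAbs := by rw [Int.natAbs_mul, Int.natAbs_mul]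
      _ ≤ S * max x.natAbs y.natAbs + S * max x.natAbs y.natAbs := by
          gcongr
          · exact le_max_left _ _
          · exact le_max_right _ _
      _ = _ := by ring
  have hi := hle i
  have hj := hle j
  refine max_le (hcomb u (q j) (q i) (by omega) (by omega) (by rw [hx, hy]; ring))
    (hcomb w (p j) (p i) (by omega) (by omega) (by rw [hx, hy]; ring))

lemma exists_max_pow_le_max_prod {n d : ℕ} (p q : Fin n → ℤ)
    (hpq : ∀ i j, i ≠ j → p i * q j ≠ p j * q i) {e f : Fin n → ℕ}
    (hef : ∀ i, e i = 0 ∨ f i = 0) (he : ∑ i, e i = d) (hf : ∑ i, f i = d) :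
    ∃ L : ℕ, ∀ u w : ℤ, max u.natAbs w.natAbs ^ d ≤
      L * max (∏ i, (p i * u - q i * w) ^ e i).natAbs (∏ i, (p i * u - q i * w) ^ f i).natAbs := by
  obtain ⟨L, hL⟩ := exists_max_le_max_linear_forms p q hpq
  refine ⟨L ^ d, fun u w => ?_⟩
  set h := max u.natAbs w.natAbs with hh
  have key : ∀ g : Fin n → ℕ, ∑ i, g i = d →
      (∀ i, g i ≠ 0 → h ≤ L * (p i * u - q i * w).natAbs) →
      h ^ d ≤ L ^ d * (∏ i, (p i * u - q i * w) ^ g i).natAbs := by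
    intro g hg hle
    rw [← hg, ← Finset.prod_pow_eq_pow_sum, ← Finset.prod_pow_eq_pow_sum, ← Int.natAbsHom_apply,
      map_prod, ← Finset.prod_mul_distrib]
    refine Finset.prod_le_prod' fun i _ => ?_
    rw [Int.natAbsHom_apply, Int.natAbs_pow, ← mul_pow]
    rcases eq_or_ne (g i) 0 with h0 | h0
    · simp [h0]
    · exact Nat.pow_le_pow_left (hle i h0) _
  by_cases hcase : ∀ i, e i ≠ 0 → h ≤ L * (p i * u - q i * w).natAbs
  · exact (key e he hcase).trans (Nat.mul_le_mul_left _ (le_max_left _ _))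
  · push Not at hcase
    obtain ⟨i, hi, hlt⟩ := hcase
    refine (key f hf fun j hj => ?_).trans (Nat.mul_le_mul_left _ (le_max_right _ _))
    have hij : i ≠ j := by
      rintro rfl
      exact (hef i).elim hi hj
    have h1 := hL i j hij u w
    rw [mul_max_of_nonneg _ _ (Nat.zero_le L)] at h1
    exact (le_max_iff.mp h1).resolve_left (not_le.mpr hlt)

/-- The real-variable estimate extracting a lower bound for `R` from an `abc`-type inequality. -/
lemma exists_rpow_le_of_abc_inequality {d k C K ε : ℝ} (hd : 0 < d) (hε : 0 < ε) (hC : 0 < C)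
    (hK : 0 < K) : ∃ C' : ℝ, 0 < C' ∧ ∀ h R : ℝ, 1 ≤ h → 0 < R →
      h ^ d ≤ C * (K * R * h ^ k) ^ (1 + ε / d) → h ^ (d - k - ε) ≤ C' * R := by
  have hη : 0 < 1 + ε / d := by positivity
  refine ⟨C ^ (1 + ε / d)⁻¹ * K, by positivity, fun h R hh hR hle => ?_⟩
  have hh0 : 0 < h := by positivity
  have h1 := Real.rpow_le_rpow (by positivity) hle (inv_nonneg.mpr hη.le)
  rw [← Real.rpow_mul hh0.le, Real.mul_rpow hC.le (by positivity), ← Real.rpow_mul (by positivity),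
    mul_inv_cancel₀ hη.ne', Real.rpow_one] at h1
  have h2 : d - ε ≤ d * (1 + ε / d)⁻¹ := by
    rw [← div_eq_mul_inv, le_div_iff₀ hη]
    have : (d - ε) * (1 + ε / d) = d - ε ^ 2 / d := by field_simp; ring
    rw [this]
    have : 0 ≤ ε ^ 2 / d := by positivity
    linarith
  have h3 := (Real.rpow_le_rpow_of_exponent_le hh h2).trans h1
  rw [show d - k - ε = (d - ε) - k by ring, Real.rpow_sub hh0, div_le_iff₀ (by positivity)]
  calc _ ≤ _ := h3
    _ = _ := by ring

/-- The `abc`-conjecture gives a lower bound for the radicals of pairwise non-proportional linear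
forms, one of which is the second coordinate. -/
lemma ABCConjecture.rpow_le_prod_radN (habc : ABCConjecture) {n : ℕ} (hn : 2 ≤ n)
    (p q : Fin n → ℤ) (hp : ∀ i, p i ≠ 0) (hpq : ∀ i j, i ≠ j → p i * q j ≠ p j * q i)
    {ε : ℝ} (hε : 0 < ε) :
    ∃ C : ℝ, 0 < C ∧ ∀ u w : ℤ, IsCoprime u w → w ≠ 0 → (∀ i, p i * u - q i * w ≠ 0) →
      ((max u.natAbs w.natAbs : ℕ) : ℝ) ^ ((n : ℝ) - 1 - ε) ≤
        C * (radN w.natAbs * ∏ i, radN (p i * u - q i * w).natAbs : ℕ) := by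
  obtain ⟨e, f, k, c, c', G, K, hef, he, hf, hc, hc', hG, hGK⟩ := exists_belyi_forms hn p q hp hpq
  obtain ⟨L, hL⟩ := exists_max_pow_le_max_prod p q hpq hef he hf
  set d := k + (n - 1) with hd
  have hd0 : 0 < d := by omega
  have hdR : (0 : ℝ) < d := by exact_mod_cast hd0
  obtain ⟨C, hC, habc'⟩ := habc.natAbs_bound_of_combination (ε := ε / d) (by positivity)
  set N : ℤ := ∏ i, ∏ j, if i = j then 1 else ((p j * q i - p i * q j) ^ e i) ^ f j with hN
  have hN0 : N ≠ 0 := by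
    refine Finset.prod_ne_zero_iff.mpr fun i _ => Finset.prod_ne_zero_iff.mpr fun j _ => ?_
    split_ifs with hij
    · exact one_ne_zero
    · exact pow_ne_zero _ (pow_ne_zero _ (sub_ne_zero.mpr (hpq j i (Ne.symm hij))))
  set N' := c * c' * N with hN'
  have hN'0 : N' ≠ 0 := mul_ne_zero (mul_ne_zero hc hc') hN0
  obtain ⟨C', hC', hfin⟩ := exists_rpow_le_of_abc_inequality (d := d) (k := k) (ε := ε)
    (C := ((L : ℝ) + 1) * (N'.natAbs * C)) (K := (c * c').natAbs * ((K : ℝ) + 1)) hdR hε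
    (by have := Int.natAbs_pos.mpr hN'0; positivity)
    (by have := Int.natAbs_pos.mpr (mul_ne_zero hc hc'); positivity)
  refine ⟨C', hC', fun u w hcop hw hl => ?_⟩
  set h := max u.natAbs w.natAbs with hh
  have hh1 : 1 ≤ h := (Int.natAbs_pos.mpr hw).trans_le (le_max_right _ _)
  set A := ∏ i, (p i * u - q i * w) ^ e i with hA
  set B := ∏ i, (p i * u - q i * w) ^ f i with hB
  set R := radN w.natAbs * ∏ i, radN (p i * u - q i * w).natAbs with hR
  have hR0 : 0 < R := Nat.mul_pos (radN_pos _) (Finset.prod_pos fun i _ => radN_pos _)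
  have hA0 : A ≠ 0 := Finset.prod_ne_zero_iff.mpr fun i _ => pow_ne_zero _ (hl i)
  have hB0 : B ≠ 0 := Finset.prod_ne_zero_iff.mpr fun i _ => pow_ne_zero _ (hl i)
  have hcomb : ∃ s t, s * (c * A) + t * (c' * B) = N' := by
    obtain ⟨s, t, hst⟩ := combination_prod_pow (l := fun i => p i * u - q i * w)
      (N := fun i j => p j * q i - p i * q j) hef
      fun i j _ => combination_linear_forms hcop (p i) (q i) (p j) (q j)
    exact ⟨c' * s, c * t, by rw [hN', hN, ← hst]; ring⟩
  have hrad : radN (c * A * (c' * B) * (c * A - c' * B)).natAbs ≤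
      (c * c').natAbs * (K + 1) * R * h ^ k := by
    have hAB : (A * B).natAbs = ∏ i, (p i * u - q i * w).natAbs ^ (e i + f i) := by
      rw [hA, hB, ← Finset.prod_mul_distrib, ← Int.natAbsHom_apply, map_prod]
      refine Finset.prod_congr rfl fun i _ => ?_
      rw [Int.natAbsHom_apply, ← pow_add, Int.natAbs_pow]
    have hGb : radN (G u w).natAbs ≤ (K + 1) * h ^ k := by
      refine (radN_le_max _).trans (max_le ?_ ?_)
      · exact Nat.mul_pos (Nat.succ_pos _) (pow_pos hh1 _)
      · exact (hGK u w).trans (Nat.mul_le_mul_right _ (Nat.le_succ _))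
    have hcc : radN (c * c').natAbs ≤ (c * c').natAbs :=
      (radN_le_max _).trans (max_le (Int.natAbs_pos.mpr (mul_ne_zero hc hc')) le_rfl)
    rw [hG u w hw, show c * A * (c' * B) * (w ^ (n - 1) * G u w) =
      (c * c') * ((A * B) * (w ^ (n - 1) * G u w)) by ring]
    rw [Int.natAbs_mul, Int.natAbs_mul (A * B), Int.natAbs_mul (w ^ (n - 1)), Int.natAbs_pow, hAB]
    calc _ ≤ _ := radN_mul_le _ _
      _ ≤ radN (c * c').natAbs * (_ * _) := Nat.mul_le_mul_left _ (radN_mul_le _ _)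
      _ ≤ (c * c').natAbs * ((∏ i, radN (p i * u - q i * w).natAbs) *
          (radN w.natAbs * ((K + 1) * h ^ k))) := by
        refine Nat.mul_le_mul hcc (Nat.mul_le_mul (radN_prod_pow_le _ _ _) ?_)
        exact (radN_mul_le _ _).trans (Nat.mul_le_mul (radN_pow_le _ _) hGb)
      _ = _ := by rw [hR]; ring
  have hexp : (0 : ℝ) ≤ 1 + ε / d := by positivity
  set Q : ℝ := ((c * c').natAbs * ((K : ℝ) + 1) * R * (h : ℝ) ^ (k : ℝ)) ^ (1 + ε / (d : ℝ)) with hQ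
  have hradR : (radN (c * A * (c' * B) * (c * A - c' * B)).natAbs : ℝ) ^ (1 + ε / (d : ℝ)) ≤ Q := by
    refine Real.rpow_le_rpow (by positivity) ?_ hexp
    rw [Real.rpow_natCast]
    exact_mod_cast hrad
  have hcA := habc' (c * A) (c' * B) N' (mul_ne_zero hc hA0) (mul_ne_zero hc' hB0) hN'0 hcomb
  have hcB := habc' (c' * B) (c * A) N' (mul_ne_zero hc' hB0) (mul_ne_zero hc hA0) hN'0
    (combination_symm hcomb)
  rw [show c' * B * (c * A) * (c' * B - c * A) = -(c * A * (c' * B) * (c * A - c' * B)) by ring,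
    Int.natAbs_neg] at hcB
  have hAle : (A.natAbs : ℝ) ≤ N'.natAbs * C * Q := by
    have h1 : A.natAbs ≤ (c * A).natAbs := by
      rw [Int.natAbs_mul]
      exact Nat.le_mul_of_pos_left _ (Int.natAbs_pos.mpr hc)
    calc (A.natAbs : ℝ) ≤ (c * A).natAbs := by exact_mod_cast h1
      _ ≤ _ := hcA
      _ ≤ _ := by gcongr
  have hBle : (B.natAbs : ℝ) ≤ N'.natAbs * C * Q := by
    have h1 : B.natAbs ≤ (c' * B).natAbs := by
      rw [Int.natAbs_mul]
      exact Nat.le_mul_of_pos_left _ (Int.natAbs_pos.mpr hc')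
    calc (B.natAbs : ℝ) ≤ (c' * B).natAbs := by exact_mod_cast h1
      _ ≤ _ := hcB
      _ ≤ _ := by gcongr
  have hmain := hfin h R (by exact_mod_cast hh1) (by exact_mod_cast hR0) (by
    have h1 : (h : ℝ) ^ d ≤ L * max (A.natAbs : ℝ) B.natAbs := by exact_mod_cast hL u w
    rw [Real.rpow_natCast, mul_assoc]
    refine h1.trans (mul_le_mul (by linarith) (max_le hAle hBle) ?_ (by positivity))
    exact (Nat.cast_nonneg _).trans (le_max_left _ _))
  have hexp' : (d : ℝ) - k - ε = (n : ℝ) - 1 - ε := by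
    rw [hd]
    push_cast [Nat.cast_sub (show 1 ≤ n by omega)]
    ring
  rwa [hexp'] at hmain

lemma max_natAbs_linear_le (a b c d x y : ℤ) :
    max (a * x + b * y).natAbs (c * x + d * y).natAbs ≤
      (a.natAbs + b.natAbs + c.natAbs + d.natAbs) * max x.natAbs y.natAbs := by
  have key : ∀ r s : ℤ, (r * x + s * y).natAbs ≤ (r.natAbs + s.natAbs) * max x.natAbs y.natAbs := by
    intro r s
    refine (Int.natAbs_add_le _ _).trans ?_
    rw [Int.natAbs_mul, Int.natAbs_mul, add_mul]
    gcongr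
    · exact le_max_left _ _
    · exact le_max_right _ _
  refine max_le ((key a b).trans ?_) ((key c d).trans ?_) <;>
  · refine Nat.mul_le_mul_right _ ?_
    omega

/-- Under the `abc`-conjecture, the radicals of `n` linear forms at coprime arguments of size `h`
have product at least of order `h ^ (n - 2 - ε)`. -/
lemma ABCConjecture.rpow_le_prod_radN_ell (habc : ABCConjecture) {n : ℕ} (hn : 3 ≤ n)
    (α β : Fin n → ℤ) (hαβ : ∀ i, IsCoprime (α i) (β i))
    (hne : ∀ i j, i ≠ j → α i * β j ≠ α j * β i) {ε : ℝ} (hε : 0 < ε) (hε1 : ε ≤ 1) :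
    ∃ C : ℝ, 0 < C ∧ ∀ x y : ℤ, IsCoprime x y → (∀ i, ell (α i) (β i) x y ≠ 0) →
      ((max x.natAbs y.natAbs : ℕ) : ℝ) ^ ((n : ℝ) - 2 - ε) ≤
        C * (∏ i, radN (ell (α i) (β i) x y).natAbs : ℕ) := by
  obtain ⟨k, rfl⟩ : ∃ k, n = k + 1 := ⟨n - 1, by omega⟩
  obtain ⟨s, t, hst⟩ := hαβ 0
  set p : Fin k → ℤ := fun i => α i.succ * β 0 - α 0 * β i.succ with hp
  set q : Fin k → ℤ := fun i => -(α i.succ * s + β i.succ * t) with hq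
  obtain ⟨C, hC, hbound⟩ := habc.rpow_le_prod_radN (n := k) (by omega) p q
    (fun i => sub_ne_zero.mpr (hne _ _ (Fin.succ_ne_zero i))) (fun i j hij h => by
      refine hne i.succ j.succ (fun h' => hij (Fin.succ_injective _ h')) ?_
      simp only [hp, hq] at h
      linear_combination (-1 : ℤ) * h - (α i.succ * β j.succ - α j.succ * β i.succ) * hst) hε
  set M : ℕ := (α 0).natAbs + (-t).natAbs + (β 0).natAbs + s.natAbs with hM
  have hexp : (0 : ℝ) ≤ (k : ℝ) - 1 - ε := by
    have : (2 : ℝ) ≤ k := by exact_mod_cast (show 2 ≤ k by omega)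
    linarith
  refine ⟨((M : ℝ) + 1) ^ ((k : ℝ) - 1 - ε) * C, by positivity, fun x y hxy hell => ?_⟩
  set u := s * x + t * y with hu
  set w := α 0 * y - β 0 * x with hw
  have hx : x = α 0 * u + -t * w := by rw [hu, hw]; linear_combination (-x) * hst
  have hy : y = β 0 * u + s * w := by rw [hu, hw]; linear_combination (-y) * hst
  have hcop : IsCoprime u w := by
    obtain ⟨a, b, hab⟩ := hxy
    exact ⟨a * α 0 + b * β 0, a * (-t) + b * s, by
      rw [← hab]; linear_combination (-a) * hx - b * hy⟩
  have hl : ∀ i : Fin k, p i * u - q i * w = ell (α i.succ) (β i.succ) x y := fun i => by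
    simp only [hp, hq, ell]
    linear_combination β i.succ * hx - α i.succ * hy
  have h1 := hbound u w hcop (hell 0) fun i => by rw [hl]; exact hell _
  simp only [hl] at h1
  have h2 : max x.natAbs y.natAbs ≤ (M + 1) * max u.natAbs w.natAbs := by
    have h3 := max_natAbs_linear_le (α 0) (-t) (β 0) s u w
    rw [← hx, ← hy] at h3
    exact h3.trans (Nat.mul_le_mul_right _ (Nat.le_succ _))
  have h2' : ((max x.natAbs y.natAbs : ℕ) : ℝ) ≤ ((M : ℝ) + 1) * (max u.natAbs w.natAbs : ℕ) := by
    exact_mod_cast h2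
  rw [Fin.prod_univ_succ, show ((k + 1 : ℕ) : ℝ) - 2 - ε = (k : ℝ) - 1 - ε by push_cast; ring]
  calc _ ≤ (((M : ℝ) + 1) * (max u.natAbs w.natAbs : ℕ)) ^ ((k : ℝ) - 1 - ε) :=
        Real.rpow_le_rpow (by positivity) h2' hexp
    _ = ((M : ℝ) + 1) ^ ((k : ℝ) - 1 - ε) * ((max u.natAbs w.natAbs : ℕ) : ℝ) ^
        ((k : ℝ) - 1 - ε) := Real.mul_rpow (by positivity) (by positivity)
    _ ≤ ((M : ℝ) + 1) ^ ((k : ℝ) - 1 - ε) * (C * _) := by gcongr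
    _ = _ := by rw [← mul_assoc]; rfl

lemma cast_max_abs (x y : ℤ) : ((max |x| |y| : ℤ) : ℝ) = ((max x.natAbs y.natAbs : ℕ) : ℝ) := by
  have : max |x| |y| = ((max x.natAbs y.natAbs : ℕ) : ℤ) := by
    push_cast
    rfl
  rw [this, Int.cast_natCast]

lemma three_le_of_deltaM_neg {n : ℕ} {m : Fin n → ℕ} (h : deltaM m < 0) : 3 ≤ n := by
  by_contra! hn
  have h1 : ∑ i, (1 - (m i : ℝ)⁻¹) ≤ ∑ _i : Fin n, (1 : ℝ) :=
    Finset.sum_le_sum fun i _ => sub_le_self _ (by positivity)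
  have h2 : (n : ℝ) ≤ 2 := by exact_mod_cast (show n ≤ 2 by omega)
  simp only [Finset.sum_const, Finset.card_univ, Fintype.card_fin, nsmul_eq_mul, mul_one] at h1
  unfold deltaM at h
  linarith

lemma exists_prod_radN_le {n : ℕ} (α β : Fin n → ℤ) {m : Fin n → ℕ} (hm : ∀ i, 2 ≤ m i) :
    ∃ C : ℝ, 0 < C ∧ ∀ x y : ℤ, (x ≠ 0 ∨ y ≠ 0) → (∀ i, ell (α i) (β i) x y ≠ 0) →
      ((∏ i, radN (ell (α i) (β i) x y).natAbs : ℕ) : ℝ) ≤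
        C * ((max x.natAbs y.natAbs : ℕ) : ℝ) ^ (∑ i, (m i : ℝ)⁻¹) *
          ∏ i, (phiM (m i) ((ell (α i) (β i) x y).natAbs) : ℝ) ^ ((m i : ℝ)⁻¹) := by
  set S : Fin n → ℝ := fun i =>
    (((-β i).natAbs + (α i).natAbs + (0 : ℤ).natAbs + (0 : ℤ).natAbs : ℕ) : ℝ) + 1 with hS
  have hS0 : ∀ i, 0 < S i := fun i => by positivity
  refine ⟨∏ i, S i ^ (m i : ℝ)⁻¹, Finset.prod_pos fun i _ => Real.rpow_pos_of_pos (hS0 i) _,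
    fun x y hxy hell => ?_⟩
  set h : ℝ := ((max x.natAbs y.natAbs : ℕ) : ℝ) with hh
  have hh0 : 0 < h := by
    rw [hh]
    norm_cast
    omega
  rw [Real.rpow_sum_of_pos hh0, ← Finset.prod_mul_distrib, ← Finset.prod_mul_distrib]
  push_cast
  refine Finset.prod_le_prod (fun i _ => by positivity) fun i _ => ?_
  refine (radN_le_rpow_phiM (two_pos.trans_le (hm i)) (Int.natAbs_ne_zero.mpr (hell i))).trans ?_
  rw [← Real.mul_rpow (hS0 i).le hh0.le]
  refine mul_le_mul_of_nonneg_right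
    (Real.rpow_le_rpow (Nat.cast_nonneg _) ?_ (by positivity)) (by positivity)
  have h1 := (le_max_left _ _).trans (max_natAbs_linear_le (-β i) (α i) 0 0 x y)
  rw [show -β i * x + α i * y = ell (α i) (β i) x y by simp only [ell]; ring] at h1
  calc ((ell (α i) (β i) x y).natAbs : ℝ) ≤ _ := Nat.cast_le.mpr h1
    _ ≤ S i * h := by
      rw [Nat.cast_mul]
      exact mul_le_mul_of_nonneg_right (le_add_of_nonneg_right zero_le_one) hh0.le

lemma ABCConjecture.hasNorthcott (habc : ABCConjecture) {n : ℕ}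
    (α β : Fin n → ℤ) (hαβ : ∀ i, IsCoprime (α i) (β i))
    (hne : ∀ i j, i ≠ j → α i * β j ≠ α j * β i) {m : Fin n → ℕ} (hm : ∀ i, 2 ≤ m i)
    (hδ : deltaM m < 0) {κ : ℝ} (hκ : 0 < κ) :
    HasNorthcott α β (stackyHeight α β m (deltaM m + κ)) := by
  set ε : ℝ := min (κ / 2) 1 with hε
  have hε0 : 0 < ε := lt_min (by positivity) one_pos
  have hεκ : 0 < κ - ε := by
    have := min_le_left (κ / 2) 1
    linarith
  obtain ⟨C, hC, hrad⟩ := habc.rpow_le_prod_radN_ell (three_le_of_deltaM_neg hδ) α β hαβ hne hε0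
    (min_le_right _ _)
  obtain ⟨C', hC', hphi⟩ := exists_prod_radN_le α β hm
  intro T
  set b : ℕ := ⌈(C * C' * T) ^ (κ - ε)⁻¹⌉₊ with hb
  refine ((Set.finite_Icc (-b : ℤ) b).prod (Set.finite_Icc (-b : ℤ) b)).subset ?_
  rintro ⟨x, y⟩ ⟨hcop, hell, hT⟩
  simp only at hcop hell hT
  have hxy : x ≠ 0 ∨ y ≠ 0 := hcop.ne_zero_or_ne_zero
  have h1 := hrad x y hcop hell
  have h2 := hphi x y hxy hell
  rw [stackyHeight, cast_max_abs] at hT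
  set h : ℝ := ((max x.natAbs y.natAbs : ℕ) : ℝ) with hh
  have hh0 : 0 < h := by
    rw [hh]
    norm_cast
    omega
  set P := ∏ i, (phiM (m i) ((ell (α i) (β i) x y).natAbs) : ℝ) ^ ((m i : ℝ)⁻¹) with hP
  set σ := ∑ i, (m i : ℝ)⁻¹ with hσ
  have hδσ : deltaM m = 2 - n + σ := by
    simp only [deltaM, Finset.sum_sub_distrib, Finset.sum_const, Finset.card_univ,
      Fintype.card_fin, nsmul_eq_mul, mul_one, hσ]
    ring
  have h3 : h ^ (κ - ε) ≤ C * C' * T := by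
    have e1 : h ^ (κ - ε) = h ^ ((n : ℝ) - 2 - ε) * (h ^ (-σ) * h ^ (deltaM m + κ)) := by
      rw [← Real.rpow_add hh0, ← Real.rpow_add hh0, hδσ]
      congr 1
      ring
    have e2 : h ^ σ * h ^ (-σ) = 1 := by
      rw [← Real.rpow_add hh0, add_neg_cancel, Real.rpow_zero]
    calc h ^ (κ - ε) = h ^ ((n : ℝ) - 2 - ε) * (h ^ (-σ) * h ^ (deltaM m + κ)) := e1
      _ ≤ (C * (C' * h ^ σ * P)) * (h ^ (-σ) * h ^ (deltaM m + κ)) := by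
        refine mul_le_mul_of_nonneg_right (h1.trans ?_) (by positivity)
        exact mul_le_mul_of_nonneg_left h2 hC.le
      _ = C * C' * (P * h ^ (deltaM m + κ)) * (h ^ σ * h ^ (-σ)) := by ring
      _ = C * C' * (P * h ^ (deltaM m + κ)) := by rw [e2, mul_one]
      _ ≤ C * C' * T := by gcongr
  have h4 : h ≤ b := by
    have h5 := Real.rpow_le_rpow (by positivity) h3 (inv_nonneg.mpr hεκ.le)
    rw [Real.rpow_rpow_inv hh0.le hεκ.ne'] at h5
    exact h5.trans (Nat.le_ceil _)
  have h6 : max x.natAbs y.natAbs ≤ b := Nat.cast_le.mp h4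
  simp only [Set.mem_prod, Set.mem_Icc]
  omega

lemma radN_mul_of_coprime {a b : ℕ} (h : Nat.Coprime a b) : radN (a * b) = radN a * radN b := by
  unfold radN
  rw [h.primeFactors_mul, Finset.prod_union h.disjoint_primeFactors]

/-- The Northcott property for three points of the same large multiplicity implies the
`abc`-conjecture. -/
lemma abcConjecture_of_hasNorthcott
    (H : ∀ m : ℕ, 5 ≤ m → HasNorthcott ![1, 0, 1] ![0, 1, -1]
      (stackyHeight ![1, 0, 1] ![0, 1, -1] (fun _ => m) (-1 + 4 * (m : ℝ)⁻¹))) :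
    ABCConjecture := by
  intro ε hε
  obtain ⟨m, hm⟩ := exists_nat_ge (5 + 3 / ε)
  have hε3 : 0 < 3 / ε := by positivity
  have hm5 : 5 ≤ m := by
    have : (5 : ℝ) ≤ m := by linarith
    exact_mod_cast this
  have hm0 : (0 : ℝ) < m := by linarith
  set F := (H m hm5 1).toFinset with hF
  refine ⟨2 + ∑ z ∈ F, ((z.1.natAbs : ℝ) + z.2.natAbs), by positivity, ?_⟩
  intro a b c ha hb hc hab habc
  set R := radN (a * b * c) with hR
  have hR1 : (1 : ℝ) ≤ R := by exact_mod_cast radN_pos _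
  have hRε : (1 : ℝ) ≤ (R : ℝ) ^ (1 + ε) := Real.one_le_rpow hR1 (by positivity)
  have hell0 : ell 1 0 a b = b := by simp [ell]
  have hell1 : ell 0 1 a b = -a := by simp [ell]
  have hell2 : ell 1 (-1) a b = c := by
    rw [← habc, ell]; push_cast; ring
  have hcop : IsCoprime (a : ℤ) (b : ℤ) := Nat.isCoprime_iff_coprime.mpr hab
  have hne : ∀ i : Fin 3, ell (![1, 0, 1] i) (![0, 1, -1] i) a b ≠ 0 := by
    intro i
    fin_cases i
    · simpa [hell0] using hb.ne'
    · simpa [hell1] using ha.ne'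
    · simpa [hell2] using hc.ne'
  have hcR : (c : ℝ) = a + b := by exact_mod_cast habc.symm
  have hsum0 : 0 ≤ ∑ z ∈ F, ((z.1.natAbs : ℝ) + z.2.natAbs) :=
    Finset.sum_nonneg fun z _ => by positivity
  by_cases hmem : ((a : ℤ), (b : ℤ)) ∈ F
  · have h1 := Finset.single_le_sum (f := fun z : ℤ × ℤ => (z.1.natAbs : ℝ) + z.2.natAbs)
      (fun z _ => by positivity) hmem
    simp only [Int.natAbs_natCast] at h1
    calc (c : ℝ) ≤ (2 + ∑ z ∈ F, ((z.1.natAbs : ℝ) + z.2.natAbs)) * 1 := by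
          rw [hcR]; linarith
      _ ≤ _ := by gcongr
  · have hlt : 1 < stackyHeight ![1, 0, 1] ![0, 1, -1] (fun _ => m) (-1 + 4 * (m : ℝ)⁻¹) a b := by
      by_contra! hle
      exact hmem ((Set.Finite.mem_toFinset _).mpr ⟨hcop, hne, hle⟩)
    rw [stackyHeight, cast_max_abs, Fin.prod_univ_three] at hlt
    simp only [Matrix.cons_val_zero, Matrix.cons_val_one, Matrix.cons_val, hell0, hell1, hell2,
      Int.natAbs_neg, Int.natAbs_natCast] at hlt
    set h : ℝ := ((max a b : ℕ) : ℝ) with hh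
    have hh0 : 0 < h := by
      rw [hh]
      norm_cast
      omega
    have hφ : (phiM m b : ℝ) ^ (m : ℝ)⁻¹ * (phiM m a : ℝ) ^ (m : ℝ)⁻¹ *
        (phiM m c : ℝ) ^ (m : ℝ)⁻¹ ≤ (R : ℝ) ^ (1 - (m : ℝ)⁻¹) := by
      have hcc : Nat.Coprime (a * b) c := by
        rw [← habc]
        exact Nat.Coprime.mul_left (by simpa using hab) (by simpa using hab.symm)
      have hRe : (R : ℝ) = radN b * radN a * radN c := by
        rw [hR, radN_mul_of_coprime hcc, radN_mul_of_coprime hab]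
        push_cast
        ring
      rw [hRe, Real.mul_rpow (by positivity) (by positivity),
        Real.mul_rpow (by positivity) (by positivity)]
      gcongr
      · exact rpow_phiM_le (by omega) hb.ne'
      · exact rpow_phiM_le (by omega) ha.ne'
      · exact rpow_phiM_le (by omega) hc.ne'
    have hs : 0 < 1 - 4 * (m : ℝ)⁻¹ := by
      rw [sub_pos, ← div_eq_mul_inv, div_lt_one hm0]
      linarith
    have h1 : h ^ (1 - 4 * (m : ℝ)⁻¹) ≤ (R : ℝ) ^ (1 - (m : ℝ)⁻¹) := by
      have e : h ^ (-1 + 4 * (m : ℝ)⁻¹) * h ^ (1 - 4 * (m : ℝ)⁻¹) = 1 := by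
        rw [← Real.rpow_add hh0, show -1 + 4 * (m : ℝ)⁻¹ + (1 - 4 * (m : ℝ)⁻¹) = 0 by ring,
          Real.rpow_zero]
      have h2 := mul_le_mul_of_nonneg_right hlt.le (Real.rpow_nonneg hh0.le (1 - 4 * (m : ℝ)⁻¹))
      rw [one_mul, mul_assoc, e, mul_one] at h2
      exact h2.trans hφ
    have h2 : h ≤ (R : ℝ) ^ (1 + ε) := by
      have h3 := Real.rpow_le_rpow (by positivity) h1 (inv_nonneg.mpr hs.le)
      rw [Real.rpow_rpow_inv hh0.le hs.ne', ← Real.rpow_mul (by positivity)] at h3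
      refine h3.trans (Real.rpow_le_rpow_of_exponent_le hR1 ?_)
      rw [← div_eq_mul_inv, div_le_iff₀ hs]
      have h4 : 3 ≤ ε * (m - 4) := by
        have : 3 / ε ≤ m - 4 := by linarith
        rw [div_le_iff₀ hε] at this
        linarith
      have h5 : (1 + ε) * (1 - 4 * (m : ℝ)⁻¹) - (1 - (m : ℝ)⁻¹) =
          (ε * (m - 4) - 3) * (m : ℝ)⁻¹ := by
        field_simp
        ring
      have h6 : 0 ≤ (ε * (m - 4) - 3) * (m : ℝ)⁻¹ :=
        mul_nonneg (by linarith) (by positivity)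
      linarith
    have hah : (a : ℝ) ≤ h := by rw [hh]; exact_mod_cast le_max_left a b
    have hbh : (b : ℝ) ≤ h := by rw [hh]; exact_mod_cast le_max_right a b
    calc (c : ℝ) ≤ 2 * (R : ℝ) ^ (1 + ε) := by rw [hcR]; linarith
      _ ≤ _ := by
        refine mul_le_mul_of_nonneg_right ?_ (by positivity)
        linarith

/-- The `abc`-conjecture is equivalent to the stacky Vojta conjecture for stacky
curves with coarse space `ℙ¹` and negative Euler characteristic: for all data
`(𝐚, 𝐦)` with `δ(𝐦) < 0` and every `κ > 0`, the function
`H^{δ(𝐦)+κ}_{(𝐚,𝐦)} = H_{(𝐚,𝐦)} · max(|x|,|y|)^κ` has the Northcott property. -/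
theorem abc_iff_stacky_vojta :
    ABCConjecture ↔
      ∀ (n : ℕ), 1 ≤ n → ∀ (α β : Fin n → ℤ),
        (∀ i, IsCoprime (α i) (β i)) →
        (∀ i j, i ≠ j → α i * β j ≠ α j * β i) →
        ∀ (m : Fin n → ℕ), (∀ i, 2 ≤ m i) →
          deltaM m < 0 →
          ∀ κ : ℝ, 0 < κ →
            HasNorthcott α β (stackyHeight α β m (deltaM m + κ)) := by
  refine ⟨fun habc n _ α β hαβ hne m hm hδ κ hκ => habc.hasNorthcott α β hαβ hne hm hδ hκ,
    fun H => abcConjecture_of_hasNorthcott fun m hm => ?_⟩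
  have hm0 : (5 : ℝ) ≤ m := by exact_mod_cast hm
  have hδ : deltaM (fun _ : Fin 3 => m) = -1 + 3 * (m : ℝ)⁻¹ := by
    simp only [deltaM, Finset.sum_const, Finset.card_univ, Fintype.card_fin, nsmul_eq_mul]
    push_cast
    ring
  have hδ0 : deltaM (fun _ : Fin 3 => m) < 0 := by
    have : 3 * (m : ℝ)⁻¹ < 1 := by
      rw [← div_eq_mul_inv, div_lt_one (by linarith)]
      linarith
    linarith
  have h := H 3 (by norm_num) ![1, 0, 1] ![0, 1, -1]
    (fun i => by
      fin_cases i
      · exact isCoprime_one_left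
      · exact isCoprime_one_right
      · exact isCoprime_one_left)
    (fun i j hij => by fin_cases i <;> fin_cases j <;> simp_all)
    (fun _ => m) (fun _ => by omega) hδ0 (m : ℝ)⁻¹ (by positivity)
  rwa [hδ, show -1 + 3 * (m : ℝ)⁻¹ + (m : ℝ)⁻¹ = -1 + 4 * (m : ℝ)⁻¹ by ring] at h
end

section
/- Let 1 ≤ k ≤ n and set δ(𝐦^{(k)}) = 2 − Σ_{i=1}^k (1 − 1/m_i). Suppose the Northcott property fails for the anti-canonical height of the totally ramified canonical cover 𝔛(ℙ¹ : (a_1,m_1), …, (a_k,m_k)); that is, suppose there is a real C_k such that infinitely many coprime pairs (x,y), up to simultaneous sign change, satisfy ℓ_i(x,y) ≠ 0 for all 1 ≤ i ≤ n and ∏_{i=1}^k φ_{m_i}(|ℓ_i(x,y)|)^{1/m_i} · max(|x|,|y|)^{δ(𝐦^{(k)})} ≤ C_k. Then there is a real C such that infinitely many coprime pairs (x,y), up to simultaneous sign change, satisfy ℓ_i(x,y) ≠ 0 for all i and H_{(𝐚,𝐦)}(x,y) ≤ C; that is, the Northcott property also fails for H_{(𝐚,𝐦)} on 𝔛(ℙ¹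 : (𝐚,𝐦)). -/
open Finset

/-- `φ_m(k) ≤ k^(m-1)`, since `k * k^(m-1) = k^m`. -/
lemma phiM_le_pow {m k : ℕ} (hm : m ≠ 0) (hk : 0 < k) : phiM m k ≤ k ^ (m - 1) :=
  Nat.sInf_le ⟨pow_pos hk _, k, mul_pow_sub_one hm k⟩

lemma abs_ell_le (α β x y : ℤ) : |ell α β x y| ≤ (|α| + |β|) * max |x| |y| := by
  calc |α * y - β * x| ≤ |α * y| + |β * x| := abs_sub _ _
    _ = |α| * |y| + |β| * |x| := by rw [abs_mul, abs_mul]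
    _ ≤ |α| * max |x| |y| + |β| * max |x| |y| := by
        gcongr
        · exact le_max_right _ _
        · exact le_max_left _ _
    _ = (|α| + |β|) * max |x| |y| := by ring

/-- The contribution of one stacky point to the height is at most a constant times
`max(|x|,|y|)^(1 - 1/m)`. -/
lemma phiM_ell_rpow_le {m : ℕ} (hm : 1 ≤ m) (α β x y : ℤ) (h : ell α β x y ≠ 0) :
    (phiM m (ell α β x y).natAbs : ℝ) ^ ((m : ℝ)⁻¹) ≤
      ((|α| + |β| : ℤ) : ℝ) ^ (1 - (m : ℝ)⁻¹) *
        ((max |x| |y| : ℤ) : ℝ) ^ (1 - (m : ℝ)⁻¹) := by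
  have hm0 : (m : ℝ) ≠ 0 := by positivity
  have hexp : 0 ≤ 1 - (m : ℝ)⁻¹ := sub_nonneg.2 (Nat.cast_inv_le_one m)
  have hle : (((ell α β x y).natAbs : ℕ) : ℝ) ≤
      ((|α| + |β| : ℤ) : ℝ) * ((max |x| |y| : ℤ) : ℝ) := by
    rw [Nat.cast_natAbs]
    exact_mod_cast abs_ell_le α β x y
  calc (phiM m (ell α β x y).natAbs : ℝ) ^ ((m : ℝ)⁻¹)
      ≤ (((ell α β x y).natAbs : ℝ) ^ (m - 1)) ^ ((m : ℝ)⁻¹) := by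
        gcongr
        exact_mod_cast phiM_le_pow (by omega) (Int.natAbs_pos.2 h)
    _ = ((ell α β x y).natAbs : ℝ) ^ (1 - (m : ℝ)⁻¹) := by
        rw [← Real.rpow_natCast, ← Real.rpow_mul (Nat.cast_nonneg _), Nat.cast_sub hm,
          Nat.cast_one, sub_mul, mul_inv_cancel₀ hm0, one_mul]
    _ ≤ (((|α| + |β| : ℤ) : ℝ) * ((max |x| |y| : ℤ) : ℝ)) ^ (1 - (m : ℝ)⁻¹) := by
        gcongr
    _ = _ := Real.mul_rpow (by positivity) (by positivity)

lemma max_abs_pos_of_isCoprime {x y : ℤ} (h : IsCoprime x y) : 0 < max |x| |y| := by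
  rcases h.ne_zero_or_ne_zero with hx | hy
  · exact lt_max_of_lt_left (abs_pos.2 hx)
  · exact lt_max_of_lt_right (abs_pos.2 hy)

/-- The height built from all stacky points is at most a constant times the height built
from the points indexed by `s`. -/
lemma stackyHeight_le {n : ℕ} (α β : Fin n → ℤ) (m : Fin n → ℕ) (hm : ∀ i, 1 ≤ m i)
    (s : Finset (Fin n)) {x y : ℤ} (hxy : IsCoprime x y)
    (h : ∀ i, ell (α i) (β i) x y ≠ 0) :
    stackyHeight α β m (deltaM m) x y ≤
      (∏ i ∈ sᶜ, ((|α i| + |β i| : ℤ) : ℝ) ^ (1 - (m i : ℝ)⁻¹)) *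
        ((∏ i ∈ s, (phiM (m i) ((ell (α i) (β i) x y).natAbs) : ℝ) ^ ((m i : ℝ)⁻¹)) *
          ((max |x| |y| : ℤ) : ℝ) ^ (2 - ∑ i ∈ s, (1 - (m i : ℝ)⁻¹))) := by
  have hM : (0 : ℝ) < ((max |x| |y| : ℤ) : ℝ) := by
    exact_mod_cast max_abs_pos_of_isCoprime hxy
  have hδ : 2 - ∑ i ∈ s, (1 - (m i : ℝ)⁻¹) =
      ∑ i ∈ sᶜ, (1 - (m i : ℝ)⁻¹) + deltaM m := by
    rw [deltaM, ← Finset.sum_add_sum_compl s]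
    ring
  have hprod := Finset.prod_le_prod (s := sᶜ) (fun i _ => by positivity)
    (fun i _ => phiM_ell_rpow_le (hm i) (α i) (β i) x y (h i))
  rw [Finset.prod_mul_distrib, ← Real.rpow_sum_of_pos hM] at hprod
  rw [stackyHeight, ← Finset.prod_mul_prod_compl s, hδ, Real.rpow_add hM]
  refine (mul_le_mul_of_nonneg_right (mul_le_mul_of_nonneg_left hprod
    (Finset.prod_nonneg fun i _ => by positivity)) (by positivity)).trans_eq ?_
  ring

/-- If the Northcott property fails for the anticanonical height of the totally
ramified canonical cover `𝔛(ℙ¹ : (a₁,m₁), …, (a_k,m_k))` (the height built from the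
first `k` stacky points, with exponent `δ(𝐦^{(k)}) = 2 − ∑_{i<k} (1 − 1/mᵢ)`), then it
also fails for the anticanonical height `H_{(𝐚,𝐦)}` of `𝔛(ℙ¹ : (𝐚,𝐦))`. -/
theorem northcott_failure_lifts_from_cover
    (n : ℕ) (hn : 1 ≤ n) (α β : Fin n → ℤ)
    (hprim : ∀ i, IsCoprime (α i) (β i))
    (hdist : ∀ i j, i ≠ j → α i * β j ≠ α j * β i)
    (m : Fin n → ℕ) (hm : ∀ i, 2 ≤ m i)
    (k : ℕ) (hk1 : 1 ≤ k) (hkn : k ≤ n)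
    (Ck : ℝ)
    (hfail : {p : ℤ × ℤ | IsCoprime p.1 p.2 ∧
        (∀ i, ell (α i) (β i) p.1 p.2 ≠ 0) ∧
        (∏ i ∈ Finset.univ.filter (fun i : Fin n => (i : ℕ) < k),
            (phiM (m i) ((ell (α i) (β i) p.1 p.2).natAbs) : ℝ) ^ ((m i : ℝ)⁻¹)) *
          ((max |p.1| |p.2| : ℤ) : ℝ) ^
            (2 - ∑ i ∈ Finset.univ.filter (fun i : Fin n => (i : ℕ) < k),
              (1 - (m i : ℝ)⁻¹)) ≤ Ck}.Infinite) :
    ∃ C : ℝ, {p : ℤ × ℤ | IsCoprime p.1 p.2 ∧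
        (∀ i, ell (α i) (β i) p.1 p.2 ≠ 0) ∧
        stackyHeight α β m (deltaM m) p.1 p.2 ≤ C}.Infinite := by
  set s : Finset (Fin n) := Finset.univ.filter (fun i : Fin n => (i : ℕ) < k)
  refine ⟨(∏ i ∈ sᶜ, ((|α i| + |β i| : ℤ) : ℝ) ^ (1 - (m i : ℝ)⁻¹)) * Ck,
    hfail.mono ?_⟩
  rintro ⟨x, y⟩ ⟨hxy, hne, hle⟩
  exact ⟨hxy, hne, (stackyHeight_le α β m (fun i => one_le_two.trans (hm i)) s hxy hne).trans
    (mul_le_mul_of_nonneg_left hle (Finset.prod_nonneg fun i _ => by positivity))⟩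
end
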